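/- arXiv:2010.08368 — 2 statements merged into one kernel-verified Lean document; each statement's English description precedes it below -/
import Mathlib

section
/- Every finite simple graph with no isolated vertex has a total dominating sequence of even length. -/
open SimpleGraph

/-- `A ⊆ V(G)` is a total dominating set of `G`: every vertex has a neighbor in `A`. -/
def TotalDomSet {V : Type*} (G : SimpleGraph V) (A : Set V) : Prop :=
  ∀ v : V, ∃ a ∈ A, G.Adj v a

/-- `s` is a legal (open neighborhood) sequence of `G`: the vertices are distinct and every
vertex after the first has a neighbor adjacent to no vertex preceding it in the sequence. -/
def LegalSeq {V : Type*} (G : SimpleGraph V) (s : List V) : Prop :=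
  s.Nodup ∧ ∀ (i : ℕ) (h : i < s.length), 0 < i →
    ∃ w : V, G.Adj (s.get ⟨i, h⟩) w ∧ ∀ u ∈ s.take i, ¬ G.Adj u w

/-- `s` is a total dominating sequence of `G`: a legal sequence whose underlying set is a
total dominating set. -/
def TotalDomSeq {V : Type*} (G : SimpleGraph V) (s : List V) : Prop :=
  LegalSeq G s ∧ TotalDomSet G {v | v ∈ s}

/-- The total domination number `γ_t(G)`: the minimum size of a total dominating set. -/
noncomputable def totalDomNum {V : Type*} (G : SimpleGraph V) : ℕ :=
  sInf {n | ∃ A : Set V, TotalDomSet G A ∧ A.ncard = n}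

/-- The Grundy total domination number `γ_gr^t(G)`: the maximum length of a total dominating
sequence. -/
noncomputable def grundyTotalDomNum {V : Type*} (G : SimpleGraph V) : ℕ :=
  sSup {n | ∃ s : List V, TotalDomSeq G s ∧ s.length = n}

/-- `G` is total `k`-uniform if `γ_t(G) = γ_gr^t(G) = k`. -/
def TotalKUniform {V : Type*} (G : SimpleGraph V) (k : ℕ) : Prop :=
  totalDomNum G = k ∧ grundyTotalDomNum G = k

/-- `G` has no isolated vertices. -/
def NoIsolatedVerts {V : Type*} (G : SimpleGraph V) : Prop :=
  ∀ v : V, ∃ w : V, G.Adj v w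

/-- The closed neighborhood `N[v] = N(v) ∪ {v}`. -/
def closedNbhd {V : Type*} (G : SimpleGraph V) (v : V) : Set V :=
  insert v (G.neighborSet v)

/-- `G` is false twin-free: no two distinct vertices have the same (open) neighborhood. -/
def FalseTwinFree {V : Type*} (G : SimpleGraph V) : Prop :=
  ∀ u v : V, u ≠ v → G.neighborSet u ≠ G.neighborSet v

/-- A list of edges `(vᵢ, wᵢ)` such that `wᵢ` is adjacent to no earlier `vⱼ`; such a list
certifies that `v₁, …, v_m` is a legal sequence. -/
def FootprintList {V : Type*} (G : SimpleGraph V) (l : List (V × V)) : Prop :=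
  (∀ p ∈ l, G.Adj p.1 p.2) ∧ l.Pairwise fun p q => ¬ G.Adj p.1 q.2

namespace FootprintList

variable {V : Type*} {G : SimpleGraph V} {l : List (V × V)}

theorem nodup_map_fst (h : FootprintList G l) : (l.map Prod.fst).Nodup := by
  rw [List.Nodup, List.pairwise_map]
  refine h.2.imp_of_mem fun {p q} _ hq hpq heq => hpq ?_
  rw [heq]
  exact h.1 q hq

theorem legalSeq (h : FootprintList G l) : LegalSeq G (l.map Prod.fst) := by
  refine ⟨h.nodup_map_fst, fun i hi _ => ?_⟩
  have hi' : i < l.length := by simpa using hi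
  refine ⟨l[i].2, by simpa using h.1 _ (List.getElem_mem hi'), fun u hu => ?_⟩
  obtain ⟨j, hj, rfl⟩ := List.mem_iff_getElem.1 hu
  simp only [List.length_take, List.length_map, lt_min_iff] at hj
  simpa using List.pairwise_iff_getElem.1 h.2 j i hj.2 hi' hj.1

/-- If the first coordinates are pairwise nonadjacent, then running back through the second
coordinates extends the certificate. -/
theorem append_reverse_swap (h : FootprintList G l)
    (hind : ∀ p ∈ l, ∀ q ∈ l, ¬ G.Adj p.1 q.1) :
    FootprintList G (l ++ (l.map Prod.swap).reverse) := by
  refine ⟨fun p hp => ?_, ?_⟩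
  · simp only [List.mem_append, List.mem_reverse, List.mem_map] at hp
    rcases hp with hp | ⟨q, hq, rfl⟩
    · exact h.1 p hp
    · exact (h.1 q hq).symm
  · refine List.pairwise_append.2 ⟨h.2, ?_, fun p hp q hq => ?_⟩
    · rw [List.pairwise_reverse, List.pairwise_map]
      exact h.2.imp fun hpq hadj => hpq hadj.symm
    · simp only [List.mem_reverse, List.mem_map] at hq
      obtain ⟨r, hr, rfl⟩ := hq
      exact hind p hp r hr

/-- Among the certificates whose first coordinates lie in `S` there is a longest one. -/
theorem exists_longest [Finite V] (G : SimpleGraph V) (S : Set V) :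
    ∃ l, (FootprintList G l ∧ ∀ p ∈ l, p.1 ∈ S) ∧
      ∀ l', FootprintList G l' → (∀ p ∈ l', p.1 ∈ S) → l'.length ≤ l.length := by
  classical
  have := Fintype.ofFinite V
  let P : ℕ → Prop := fun n => ∃ l, (FootprintList G l ∧ ∀ p ∈ l, p.1 ∈ S) ∧ l.length = n
  have hbound : ∀ n, P n → n ≤ Fintype.card V := by
    rintro n ⟨l, ⟨hl, -⟩, rfl⟩
    simpa using hl.nodup_map_fst.length_le_card
  have hzero : P 0 := ⟨[], ⟨⟨by simp, List.Pairwise.nil⟩, by simp⟩, rfl⟩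
  obtain ⟨l, hl, hlen⟩ := Nat.findGreatest_spec (Nat.zero_le (Fintype.card V)) hzero
  refine ⟨l, hl, fun l' hl' hS => ?_⟩
  rw [hlen]
  exact Nat.le_findGreatest (hbound _ ⟨l', ⟨hl', hS⟩, rfl⟩) ⟨l', ⟨hl', hS⟩, rfl⟩

end FootprintList

/-- Every finite simple graph with no isolated vertex has a total dominating sequence of even
length. -/
theorem stmt_3 {V : Type*} [Finite V] (G : SimpleGraph V) (hiso : NoIsolatedVerts G) :
    ∃ s : List V, TotalDomSeq G s ∧ Even s.length := by
  obtain ⟨S, -, hS⟩ := Finite.exists_le_maximal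
    (p := fun S : Set V => ∀ u ∈ S, ∀ v ∈ S, ¬ G.Adj u v) (a := ∅) (by simp)
  obtain ⟨l, ⟨hl, hlS⟩, hmax⟩ := FootprintList.exists_longest G S
  refine ⟨(l ++ (l.map Prod.swap).reverse).map Prod.fst,
    ⟨(hl.append_reverse_swap fun p hp q hq => hS.prop _ (hlS p hp) _ (hlS q hq)).legalSeq,
      fun v => ?_⟩, by simp⟩
  by_contra hv
  have hfst : ∀ p ∈ l, ¬ G.Adj v p.1 := fun p hp hadj =>
    hv ⟨p.1, List.mem_map_of_mem (List.mem_append_left _ hp), hadj⟩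
  have hsnd : ∀ p ∈ l, ¬ G.Adj v p.2 := fun p hp hadj =>
    hv ⟨p.2, List.mem_map_of_mem (f := Prod.fst) (a := p.swap)
      (List.mem_append_right _ (by simpa using hp)), hadj⟩
  by_cases hvS : v ∈ S
  · obtain ⟨w, hw⟩ := hiso v
    have := hmax ((v, w) :: l)
      ⟨List.forall_mem_cons.2 ⟨hw, hl.1⟩, List.pairwise_cons.2 ⟨hsnd, hl.2⟩⟩
      (List.forall_mem_cons.2 ⟨hvS, hlS⟩)
    simp at this
  · obtain ⟨u, huS, hu⟩ : ∃ u ∈ S, G.Adj u v := by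
      by_contra! hnone
      refine hvS (hS.le_of_ge (y := insert v S) ?_ (Set.subset_insert v S) (Set.mem_insert v S))
      rintro a (rfl | ha) b (rfl | hb)
      · exact G.irrefl
      · exact fun hadj => hnone b hb hadj.symm
      · exact hnone a ha
      · exact hS.prop a ha b hb
    have := hmax (l ++ [(u, v)])
      ⟨List.forall_mem_append.2 ⟨hl.1, by simpa using hu⟩,
        List.pairwise_append.2 ⟨hl.2, List.pairwise_singleton _ _, fun p hp q hq hadj => by
          rw [List.mem_singleton] at hq
          subst hq
          exact hfst p hp hadj.symm⟩⟩
      (List.forall_mem_append.2 ⟨hlS, by simpa using huS⟩)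
    simp at this
end

section
/- Let k ≥ 4 be an even integer, let G be a total k-uniform, false twin-free graph with no isolated vertices, and let uv be an edge of G. Then the subgraph of G induced by V(G) \ (N[u] ∪ N[v]) is total (k−2)-uniform, false twin-free, and has no isolated vertices. -/
open SimpleGraph

/-- The set of vertices with a neighbor in the list `s`. -/
def domSet {V : Type*} (G : SimpleGraph V) (s : List V) : Set V :=
  {w | ∃ a ∈ s, G.Adj a w}

/-- Relative to a set `D` of already dominated vertices, every vertex of the list dominates a
vertex outside `D` that no earlier vertex of the list dominates. -/
def LegalFrom {V : Type*} (G : SimpleGraph V) : Set V → List V → Prop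
  | _, [] => True
  | D, a :: s => (∃ w, w ∉ D ∧ G.Adj a w) ∧ LegalFrom G (D ∪ G.neighborSet a) s

section Legal

variable {V : Type*} {G : SimpleGraph V}

theorem domSet_nil : domSet G [] = ∅ := by
  simp [domSet]

theorem domSet_cons (a : V) (s : List V) :
    domSet G (a :: s) = G.neighborSet a ∪ domSet G s := by
  ext w
  simp [domSet]

theorem domSet_append (s t : List V) :
    domSet G (s ++ t) = domSet G s ∪ domSet G t := by
  ext w
  simp [domSet, or_and_right, exists_or]

theorem LegalFrom.append {s t : List V} : ∀ {D : Set V},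
    LegalFrom G D s → LegalFrom G (D ∪ domSet G s) t → LegalFrom G D (s ++ t) := by
  induction s with
  | nil =>
    intro D _ h
    simpa [domSet_nil] using h
  | cons a s ih =>
    intro D hs h
    refine ⟨hs.1, ih hs.2 ?_⟩
    rwa [domSet_cons, ← Set.union_assoc] at h

theorem LegalFrom.mono {s : List V} : ∀ {D E : Set V}, D ⊆ E →
    LegalFrom G E s → LegalFrom G D s := by
  induction s with
  | nil => intros; trivial
  | cons a s ih =>
    rintro D E h ⟨⟨w, hw, haw⟩, hs⟩
    exact ⟨⟨w, fun hD => hw (h hD), haw⟩, ih (Set.union_subset_union_left _ h) hs⟩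

theorem legalFrom_iff {s : List V} : ∀ {D : Set V}, LegalFrom G D s ↔
    ∀ (i : ℕ) (h : i < s.length),
      ∃ w, w ∉ D ∧ G.Adj (s.get ⟨i, h⟩) w ∧ ∀ u ∈ s.take i, ¬ G.Adj u w := by
  induction s with
  | nil => simp [LegalFrom]
  | cons a s ih =>
    intro D
    constructor
    · rintro ⟨⟨w, hw, haw⟩, hs⟩ i h
      cases i with
      | zero => exact ⟨w, hw, haw, by simp⟩
      | succ i =>
        obtain ⟨w, hw, h1, h2⟩ := ih.1 hs i (by simpa using h)
        simp only [Set.mem_union, mem_neighborSet, not_or] at hw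
        refine ⟨w, hw.1, h1, ?_⟩
        simpa using ⟨hw.2, h2⟩
    · intro H
      constructor
      · obtain ⟨w, hw, h1, -⟩ := H 0 (by simp)
        exact ⟨w, hw, h1⟩
      · refine ih.2 fun i h => ?_
        obtain ⟨w, hw, h1, h2⟩ := H (i + 1) (by simpa using h)
        simp only [List.take_succ_cons, List.mem_cons, forall_eq_or_imp] at h2
        exact ⟨w, by simp [hw, h2.1], h1, h2.2⟩

theorem LegalFrom.exists_of_mem {s : List V} {D : Set V} (hs : LegalFrom G D s) {a : V}
    (ha : a ∈ s) : ∃ w, w ∉ D ∧ G.Adj a w := by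
  obtain ⟨i, rfl⟩ := List.get_of_mem ha
  obtain ⟨w, hw, h, -⟩ := legalFrom_iff.1 hs i i.2
  exact ⟨w, hw, h⟩

theorem LegalFrom.nodup {s : List V} : ∀ {D : Set V}, LegalFrom G D s → s.Nodup := by
  induction s with
  | nil => simp
  | cons a s ih =>
    rintro D ⟨-, hs⟩
    refine List.nodup_cons.2 ⟨fun ha => ?_, ih hs⟩
    obtain ⟨w, hw, haw⟩ := hs.exists_of_mem ha
    exact hw (Or.inr haw)

theorem LegalFrom.legalSeq {s : List V} (hs : LegalFrom G ∅ s) : LegalSeq G s :=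
  ⟨hs.nodup, fun i h _ => by
    obtain ⟨w, -, hw⟩ := legalFrom_iff.1 hs i h
    exact ⟨w, hw⟩⟩

theorem LegalSeq.legalFrom (hiso : NoIsolatedVerts G) {s : List V} (hs : LegalSeq G s) :
    LegalFrom G ∅ s := by
  refine legalFrom_iff.2 fun i h => ?_
  rcases Nat.eq_zero_or_pos i with rfl | hi
  · obtain ⟨w, hw⟩ := hiso (s.get ⟨0, h⟩)
    exact ⟨w, by simp, hw, by simp⟩
  · obtain ⟨w, hw⟩ := hs.2 i h hi
    exact ⟨w, by simp, hw⟩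

theorem totalDomSet_of_domSet_eq_univ {s : List V} (hs : ∀ w, w ∈ domSet G s) :
    TotalDomSet G {v | v ∈ s} := fun w => by
  obtain ⟨a, ha, haw⟩ := hs w
  exact ⟨a, ha, haw.symm⟩

/-- Greedily choosing vertices of `W` exhausts everything that `W` dominates. -/
theorem exists_legalFrom_extension [Finite V] (W D : Set V) :
    ∃ t : List V, (∀ a ∈ t, a ∈ W) ∧ LegalFrom G D t ∧
      ∀ a ∈ W, G.neighborSet a ⊆ D ∪ domSet G t := by
  induction hn : Dᶜ.ncard using Nat.strong_induction_on generalizing D with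
  | _ n ih =>
    by_cases h : ∀ a ∈ W, G.neighborSet a ⊆ D
    · exact ⟨[], by simp, trivial, by simpa [domSet_nil] using h⟩
    · push Not at h
      obtain ⟨a, ha, h⟩ := h
      obtain ⟨w, haw, hw⟩ := Set.not_subset.1 h
      obtain ⟨t, htW, ht, hdom⟩ := ih (D ∪ G.neighborSet a)ᶜ.ncard (by
        rw [← hn]
        refine Set.ncard_lt_ncard ?_ (Set.toFinite _)
        refine ⟨Set.compl_subset_compl.2 Set.subset_union_left, fun hsub => ?_⟩
        exact hsub hw (Or.inr haw)) _ rfl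
      refine ⟨a :: t, by simpa using ⟨ha, htW⟩, ⟨⟨w, hw, haw⟩, ht⟩, fun b hb => ?_⟩
      rw [domSet_cons, ← Set.union_assoc]
      exact hdom b hb

theorem totalDomNum_le {A : Set V} (hA : TotalDomSet G A) : totalDomNum G ≤ A.ncard :=
  Nat.sInf_le ⟨A, hA, rfl⟩

theorem ncard_setOf_mem_le (s : List V) : {v | v ∈ s}.ncard ≤ s.length := by
  classical
  have : {v | v ∈ s} = (s.toFinset : Set V) := by
    ext
    simp
  rw [this, Set.ncard_coe_finset]
  exact s.toFinset_card_le

theorem TotalDomSeq.length_le_grundyTotalDomNum [Finite V] {s : List V}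
    (hs : TotalDomSeq G s) : s.length ≤ grundyTotalDomNum G := by
  refine le_csSup ⟨Nat.card V, ?_⟩ ⟨s, hs, rfl⟩
  rintro n ⟨t, ht, rfl⟩
  have := Fintype.ofFinite V
  rw [Nat.card_eq_fintype_card]
  exact ht.1.1.length_le_card

/-- Every legal sequence extends to a total dominating sequence. -/
theorem LegalFrom.exists_extension [Finite V] (hiso : NoIsolatedVerts G) {s : List V}
    (hs : LegalFrom G ∅ s) :
    ∃ t, LegalFrom G (domSet G s) t ∧ TotalDomSeq G (s ++ t) := by
  obtain ⟨t, -, ht, hdom⟩ := exists_legalFrom_extension (G := G) Set.univ (domSet G s)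
  refine ⟨t, ht, (hs.append (by simpa using ht)).legalSeq,
    totalDomSet_of_domSet_eq_univ fun w => ?_⟩
  obtain ⟨a, ha⟩ := hiso w
  rw [domSet_append]
  exact hdom a (Set.mem_univ _) ha.symm

theorem LegalFrom.length_le [Finite V] (hiso : NoIsolatedVerts G) {s : List V}
    (hs : LegalFrom G ∅ s) : s.length ≤ grundyTotalDomNum G := by
  obtain ⟨t, -, ht⟩ := hs.exists_extension hiso
  have := ht.length_le_grundyTotalDomNum
  rw [List.length_append] at this
  omega

/-- In a graph with `γ_t = γ_gr^t`, the first vertex of a legal sequence is not redundant. -/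
theorem LegalFrom.not_subset_domSet [Finite V] (hiso : NoIsolatedVerts G)
    (huni : totalDomNum G = grundyTotalDomNum G) {x : V} {s : List V}
    (hs : LegalFrom G ∅ (x :: s)) : ¬ G.neighborSet x ⊆ domSet G s := by
  intro hx
  have hs' : LegalFrom G ∅ s := hs.2.mono (Set.empty_subset _)
  obtain ⟨t, ht, htd⟩ := hs'.exists_extension hiso
  have h1 := (totalDomNum_le htd.2).trans (ncard_setOf_mem_le _)
  have h2 : LegalFrom G ∅ ((x :: s) ++ t) := hs.append (by
    rwa [Set.empty_union, domSet_cons, Set.union_eq_self_of_subset_left hx])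
  have h3 := h2.length_le hiso
  simp only [List.cons_append, List.length_cons] at h3
  omega

theorem LegalFrom.map_val {W : Set V} {s : List W} : ∀ {D : Set W} {E : Set V},
    (∀ w : W, (w : V) ∈ E → w ∈ D) → LegalFrom (G.induce W) D s →
      LegalFrom G E (s.map Subtype.val) := by
  induction s with
  | nil => intros; trivial
  | cons a s ih =>
    rintro D E h ⟨⟨w, hw, haw⟩, hs⟩
    refine ⟨⟨w, fun hE => hw (h w hE), haw⟩, ih (fun w hw => ?_) hs⟩
    exact hw.imp (h w) id

end Legal

section RemoveEdge

variable {V : Type*} {G : SimpleGraph V} {u v : V}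

theorem mem_compl_closedNbhd_union_iff (hadj : G.Adj u v) {w : V} :
    w ∈ (closedNbhd G u ∪ closedNbhd G v)ᶜ ↔ ¬ G.Adj u w ∧ ¬ G.Adj v w := by
  have h1 : w = u → G.Adj v w := by rintro rfl; exact hadj.symm
  have h2 : w = v → G.Adj u w := by rintro rfl; exact hadj
  simp only [closedNbhd, Set.mem_compl_iff, Set.mem_union, Set.mem_insert_iff, mem_neighborSet]
  tauto

/-- A legal sequence avoiding the neighbors of both ends of an edge can be extended by the
two ends of that edge. -/
theorem LegalFrom.append_edge (hadj : G.Adj u v) {s : List V} (hs : LegalFrom G ∅ s)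
    (hsu : ∀ a ∈ s, ¬ G.Adj u a) (hsv : ∀ a ∈ s, ¬ G.Adj v a) :
    LegalFrom G ∅ (s ++ [u, v]) := by
  refine hs.append ⟨⟨v, ?_, hadj⟩, ⟨u, ?_, hadj.symm⟩, trivial⟩
  · rintro (h | ⟨a, ha, h⟩)
    · exact h
    · exact hsv a ha h.symm
  · rintro ((h | ⟨a, ha, h⟩) | h)
    · exact h
    · exact hsu a ha h.symm
    · exact G.irrefl h

theorem noIsolatedVerts_remove_edge [Finite V] (hiso : NoIsolatedVerts G)
    (huni : totalDomNum G = grundyTotalDomNum G) (hadj : G.Adj u v) :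
    NoIsolatedVerts (G.induce ((closedNbhd G u ∪ closedNbhd G v)ᶜ)) := by
  rintro ⟨x, hx⟩
  have hx' := (mem_compl_closedNbhd_union_iff hadj).1 hx
  have hlegal : LegalFrom G ∅ ([x] ++ [u, v]) := by
    refine LegalFrom.append_edge hadj ⟨?_, trivial⟩ (by simpa using hx'.1) (by simpa using hx'.2)
    obtain ⟨w, hw⟩ := hiso x
    exact ⟨w, by simp, hw⟩
  obtain ⟨w, hxw, hw⟩ := Set.not_subset.1 (hlegal.not_subset_domSet hiso huni)
  exact ⟨⟨w, (mem_compl_closedNbhd_union_iff hadj).2 ⟨fun h => hw ⟨u, by simp, h⟩,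
    fun h => hw ⟨v, by simp, h⟩⟩⟩, hxw⟩

theorem totalDomNum_le_remove_edge [Finite V] (hadj : G.Adj u v)
    {A : Set ((closedNbhd G u ∪ closedNbhd G v)ᶜ : Set V)}
    (hA : TotalDomSet (G.induce ((closedNbhd G u ∪ closedNbhd G v)ᶜ)) A) :
    totalDomNum G ≤ A.ncard + 2 := by
  have h : TotalDomSet G (insert u (insert v (Subtype.val '' A))) := by
    intro w
    by_cases hu : G.Adj u w
    · exact ⟨u, by simp, hu.symm⟩
    by_cases hv : G.Adj v w
    · exact ⟨v, by simp, hv.symm⟩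
    obtain ⟨a, ha, haw⟩ := hA ⟨w, (mem_compl_closedNbhd_union_iff hadj).2 ⟨hu, hv⟩⟩
    exact ⟨a, Or.inr (Or.inr ⟨a, ha, rfl⟩), haw⟩
  have h1 := totalDomNum_le h
  have h2 := Set.ncard_insert_le u (insert v (Subtype.val '' A))
  have h3 := Set.ncard_insert_le v (Subtype.val '' A)
  have h4 := Set.ncard_image_le (f := Subtype.val) (Set.toFinite A)
  omega

theorem LegalSeq.length_add_two_le_of_remove_edge [Finite V] (hiso : NoIsolatedVerts G)
    (huni : totalDomNum G = grundyTotalDomNum G) (hadj : G.Adj u v)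
    {s : List ((closedNbhd G u ∪ closedNbhd G v)ᶜ : Set V)}
    (hs : LegalSeq (G.induce ((closedNbhd G u ∪ closedNbhd G v)ᶜ)) s) :
    s.length + 2 ≤ grundyTotalDomNum G := by
  have h := (hs.legalFrom (noIsolatedVerts_remove_edge hiso huni hadj)).map_val
    (E := ∅) (by simp)
  have h' := (h.append_edge hadj
    (by simp only [List.mem_map]; rintro _ ⟨a, -, rfl⟩
        exact ((mem_compl_closedNbhd_union_iff hadj).1 a.2).1)
    (by simp only [List.mem_map]; rintro _ ⟨a, -, rfl⟩
        exact ((mem_compl_closedNbhd_union_iff hadj).1 a.2).2)).length_le hiso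
  simpa using h'

theorem totalKUniform_remove_edge [Finite V] (hiso : NoIsolatedVerts G) {k : ℕ}
    (huni : TotalKUniform G k) (hadj : G.Adj u v) :
    TotalKUniform (G.induce ((closedNbhd G u ∪ closedNbhd G v)ᶜ)) (k - 2) := by
  have heq : totalDomNum G = grundyTotalDomNum G := huni.1.trans huni.2.symm
  have hiso' := noIsolatedVerts_remove_edge hiso heq hadj
  obtain ⟨t, -, ht⟩ := LegalFrom.exists_extension hiso' (s := []) trivial
  rw [List.nil_append] at ht
  have hle : ∀ s, TotalDomSeq (G.induce ((closedNbhd G u ∪ closedNbhd G v)ᶜ)) s →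
      s.length ≤ k - 2 := fun s hs => by
    have h1 := hs.1.length_add_two_le_of_remove_edge hiso heq hadj
    rw [huni.2] at h1
    omega
  have hge : ∀ A, TotalDomSet (G.induce ((closedNbhd G u ∪ closedNbhd G v)ᶜ)) A →
      k - 2 ≤ A.ncard := fun A hA => by
    have h1 := totalDomNum_le_remove_edge hadj hA
    rw [huni.1] at h1
    omega
  have hcard := ncard_setOf_mem_le t
  constructor
  · refine le_antisymm ((totalDomNum_le ht.2).trans (hcard.trans (hle t ht))) ?_
    refine le_csInf ⟨_, _, ht.2, rfl⟩ ?_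
    rintro n ⟨A, hA, rfl⟩
    exact hge A hA
  · refine le_antisymm (csSup_le ⟨_, t, ht, rfl⟩ ?_)
      (((hge _ ht.2).trans hcard).trans ht.length_le_grundyTotalDomNum)
    rintro n ⟨s, hs, rfl⟩
    exact hle s hs

/-- If two vertices have equal neighborhoods once the closed neighborhoods of the ends of an
edge are removed, the original neighborhoods are nested (and hence, by symmetry, equal). -/
theorem neighborSet_subset_of_remove_edge [Finite V] (hiso : NoIsolatedVerts G)
    (huni : totalDomNum G = grundyTotalDomNum G) (hadj : G.Adj u v)
    {x y : ((closedNbhd G u ∪ closedNbhd G v)ᶜ : Set V)}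
    (hxy : (G.induce ((closedNbhd G u ∪ closedNbhd G v)ᶜ)).neighborSet x =
      (G.induce ((closedNbhd G u ∪ closedNbhd G v)ᶜ)).neighborSet y) :
    G.neighborSet (y : V) ⊆ G.neighborSet (x : V) := by
  by_contra hsub
  obtain ⟨w, hyw, hxw⟩ := Set.not_subset.1 hsub
  have hiso' := noIsolatedVerts_remove_edge hiso huni hadj
  have hpair : LegalFrom G ∅ [(x : V), (y : V)] := by
    obtain ⟨z, hz⟩ := hiso x
    exact ⟨⟨z, by simp, hz⟩, ⟨w, by simpa using hxw, hyw⟩, trivial⟩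
  obtain ⟨t, htW, ht, hdom⟩ := exists_legalFrom_extension (G := G)
    ((closedNbhd G u ∪ closedNbhd G v)ᶜ) (domSet G [(x : V), (y : V)])
  have hlegal := hpair.append (t := t) (by simpa using ht)
  have hW : ∀ a ∈ [(x : V), (y : V)] ++ t, a ∈ (closedNbhd G u ∪ closedNbhd G v)ᶜ := by
    simp only [List.cons_append, List.nil_append, List.forall_mem_cons]
    exact ⟨x.2, y.2, htW⟩
  have hlen := (hlegal.append_edge hadj
    (fun a ha => ((mem_compl_closedNbhd_union_iff hadj).1 (hW a ha)).1)
    (fun a ha => ((mem_compl_closedNbhd_union_iff hadj).1 (hW a ha)).2)).length_le hiso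
  have hA : TotalDomSet (G.induce ((closedNbhd G u ∪ closedNbhd G v)ᶜ))
      (Subtype.val ⁻¹' {a | a ∈ (x : V) :: t}) := by
    intro z
    obtain ⟨b, hb⟩ := hiso' z
    have hz := hdom b b.2 (show G.Adj b z from hb.symm)
    rw [← domSet_append] at hz
    obtain ⟨a, ha, haz⟩ := hz
    simp only [List.cons_append, List.nil_append, List.mem_cons] at ha
    rcases ha with rfl | rfl | ha
    · exact ⟨x, by simp, haz.symm⟩
    · have hz' : z ∈ (G.induce ((closedNbhd G u ∪ closedNbhd G v)ᶜ)).neighborSet y := haz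
      rw [← hxy] at hz'
      exact ⟨x, by simp, hz'.symm⟩
    · exact ⟨⟨a, htW a ha⟩, List.mem_cons_of_mem _ ha, haz.symm⟩
  have h1 := totalDomNum_le_remove_edge hadj hA
  have h2 := ncard_setOf_mem_le ((x : V) :: t)
  have h3 : (Subtype.val ⁻¹' {a | a ∈ (x : V) :: t} :
      Set ((closedNbhd G u ∪ closedNbhd G v)ᶜ : Set V)).ncard ≤ {a | a ∈ (x : V) :: t}.ncard := by
    rw [← Set.ncard_image_of_injective _ Subtype.val_injective]
    exact Set.ncard_le_ncard (Set.image_preimage_subset _ _) (Set.toFinite _)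
  simp only [List.length_append, List.length_cons, List.length_nil] at hlen h2
  omega

theorem falseTwinFree_remove_edge [Finite V] (hiso : NoIsolatedVerts G)
    (huni : totalDomNum G = grundyTotalDomNum G) (hftf : FalseTwinFree G) (hadj : G.Adj u v) :
    FalseTwinFree (G.induce ((closedNbhd G u ∪ closedNbhd G v)ᶜ)) := fun x y hne hxy =>
  hftf x y (Subtype.coe_injective.ne hne)
    ((neighborSet_subset_of_remove_edge hiso huni hadj hxy.symm).antisymm
      (neighborSet_subset_of_remove_edge hiso huni hadj hxy))

end RemoveEdge

/-- Let `k ≥ 4` be even, `G` a total `k`-uniform, false twin-free graph with no isolated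
vertices, and `uv` an edge of `G`. Then the subgraph induced by `V(G) \ (N[u] ∪ N[v])` is
total `(k-2)`-uniform, false twin-free, and has no isolated vertices. -/
theorem stmt_6 {V : Type*} [Finite V] (G : SimpleGraph V) (k : ℕ) (hk4 : 4 ≤ k)
    (hke : Even k) (hiso : NoIsolatedVerts G) (hftf : FalseTwinFree G)
    (huni : TotalKUniform G k) (u v : V) (hadj : G.Adj u v) :
    TotalKUniform (G.induce ((closedNbhd G u ∪ closedNbhd G v)ᶜ)) (k - 2) ∧
    FalseTwinFree (G.induce ((closedNbhd G u ∪ closedNbhd G v)ᶜ)) ∧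
    NoIsolatedVerts (G.induce ((closedNbhd G u ∪ closedNbhd G v)ᶜ)) := by
  have heq : totalDomNum G = grundyTotalDomNum G := huni.1.trans huni.2.symm
  exact ⟨totalKUniform_remove_edge hiso huni hadj,
    falseTwinFree_remove_edge hiso heq hftf hadj, noIsolatedVerts_remove_edge hiso heq hadj⟩
end
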